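/- Let P₁ = (w₁|w₂|…|w_k) and P₂ = (v₁|v₂|…|v_k) be nanophrases of length k over α. If P₁ and P₂ are homotopic as nanophrases, then for every i ∈ {1,…,k} the words w_i and v_i are homotopic as étale words over α. -/

import Mathlib

namespace Nano

variable {α : Type*}

/-- A letter: an identifier together with its projection to the alphabet `α`. -/
abbrev Letter (α : Type*) := ℕ × α

/-- The projection of a letter. -/
def proj (A : Letter α) : α := A.2

/-- A phrase: a finite sequence of words, each word a list of letters. -/
abbrev Phrase (α : Type*) := List (List (Letter α))

/-- Flatten a phrase into one list, separating components by `none` (the `|` character). -/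
def flat (P : Phrase α) : List (Option (Letter α)) :=
  List.intercalate [none] (P.map fun w => w.map some)

/-- The `i`-th component (word) of a phrase (0-indexed). -/
def comp (P : Phrase α) (i : ℕ) : List (Letter α) := P.getD i []

/-- A phrase is a Gauss phrase if every letter occurring in it occurs exactly twice. -/
def IsGauss [DecidableEq α] (P : Phrase α) : Prop :=
  ∀ A ∈ P.flatten, P.flatten.count A = 2

/-- All letters of `P` project into the subset `β` of `α`. -/
def ProjIn (β : Set α) (P : Phrase α) : Prop := ∀ A ∈ P.flatten, A.2 ∈ β

/-- Renaming of letters (injective renamings give isomorphisms of `α`-alphabets,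
preserving the projection). -/
def rename (f : ℕ → ℕ) (P : Phrase α) : Phrase α :=
  P.map (List.map fun A => (f A.1, A.2))

/-- One elementary step: an isomorphism or one of the homotopy moves (1)-(3),
for the involution `τ` on `α`. -/
inductive Move (τ : α → α) : Phrase α → Phrase α → Prop
  | iso (f : ℕ → ℕ) (hf : Function.Injective f) (P : Phrase α) :
      Move τ P (rename f P)
  | h1 (P Q : Phrase α) (A : Letter α) (x y : List (Option (Letter α)))
      (hP : flat P = x ++ [some A, some A] ++ y)
      (hQ : flat Q = x ++ y) : Move τ P Q
  | h2 (P Q : Phrase α) (A B : Letter α) (x y z : List (Option (Letter α)))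
      (hAB : B.2 = τ A.2)
      (hP : flat P = x ++ [some A, some B] ++ y ++ [some B, some A] ++ z)
      (hQ : flat Q = x ++ y ++ z) : Move τ P Q
  | h3 (P Q : Phrase α) (A B C : Letter α) (x y z t : List (Option (Letter α)))
      (hAB : A.2 = B.2) (hBC : B.2 = C.2)
      (hP : flat P = x ++ [some A, some B] ++ y ++ [some A, some C] ++ z
              ++ [some B, some C] ++ t)
      (hQ : flat Q = x ++ [some B, some A] ++ y ++ [some C, some A] ++ z
              ++ [some C, some B] ++ t) : Move τ P Q

/-- A nanophrase over the subset `β`: a Gauss phrase all of whose letters project into `β`. -/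
def NanoIn [DecidableEq α] (β : Set α) (P : Phrase α) : Prop := IsGauss P ∧ ProjIn β P

/-- Homotopy of nanophrases in the class of nanophrases over `β ⊆ α`:
a finite chain of isomorphisms, moves (1)-(3) and their inverses, all whose
terms are nanophrases over `β`. -/
def HomotopicIn [DecidableEq α] (τ : α → α) (β : Set α) (P Q : Phrase α) : Prop :=
  Relation.ReflTransGen
    (fun X Y => (Move τ X Y ∨ Move τ Y X) ∧ NanoIn β X ∧ NanoIn β Y) P Q

/-- Homotopy of nanophrases over `α`. -/
def Homotopic [DecidableEq α] (τ : α → α) (P Q : Phrase α) : Prop :=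
  HomotopicIn τ Set.univ P Q

/-! ### Desingularization -/

/-- The letter `A_{p,q}` of the desingularized alphabet. -/
def dLetter (A : Letter α) (p q : ℕ) : Letter α := (Nat.pair A.1 (Nat.pair p q), A.2)

/-- The replacement of the `i`-th occurrence (1-indexed) of a letter `A` of
multiplicity `m`: `A_{1,i} A_{2,i} ⋯ A_{i-1,i} A_{i,i+1} ⋯ A_{i,m}`. -/
def repl (A : Letter α) (i m : ℕ) : List (Letter α) :=
  ((List.range (i - 1)).map fun j => dLetter A (j + 1) i) ++
  ((List.range (m - i)).map fun j => dLetter A i (i + j + 1))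

def desingWord [DecidableEq α] (m : Letter α → ℕ) :
    List (Letter α) → (Letter α → ℕ) → List (Letter α)
  | [], _ => []
  | A :: rest, seen =>
      repl A (seen A + 1) (m A) ++
        desingWord m rest (fun B => if B = A then seen B + 1 else seen B)

def desingAux [DecidableEq α] (m : Letter α → ℕ) :
    Phrase α → (Letter α → ℕ) → Phrase α
  | [], _ => []
  | w :: ws, seen => desingWord m w seen :: desingAux m ws (fun B => seen B + w.count B)

/-- The desingularization `P^d` of an étale phrase `P`. -/
def desing [DecidableEq α] (P : Phrase α) : Phrase α :=
  desingAux (fun A => P.flatten.count A) P (fun _ => 0)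

/-- Homotopy of étale phrases: homotopy of their desingularizations. -/
def EHomotopic [DecidableEq α] (τ : α → α) (P Q : Phrase α) : Prop :=
  Homotopic τ (desing P) (desing Q)

/-! ### Phrases over `α` itself, via the identity projection -/

/-- An element of `α` regarded as a letter (identity projection). -/
def ofα (a : α) : Letter α := (0, a)

/-- The empty phrase `(∅)_k` of length `k`. -/
def emptyP (k : ℕ) : Phrase α := List.replicate k []

/-- `P^{1,1;l₁,l₂}_a`. -/
def P11 (k : ℕ) (l1 l2 : Fin k) (a : α) : Phrase α :=
  List.ofFn fun i => if i = l1 ∨ i = l2 then [ofα a] else []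

/-- `P^{3;l}_a`. -/
def P3 (k : ℕ) (l : Fin k) (a : α) : Phrase α :=
  List.ofFn fun i => if i = l then [ofα a, ofα a, ofα a] else []

/-- `P^{2,1;l₁,l₂}_a`. -/
def P21 (k : ℕ) (l1 l2 : Fin k) (a : α) : Phrase α :=
  List.ofFn fun i => if i = l1 then [ofα a, ofα a] else if i = l2 then [ofα a] else []

/-- `P^{1,2;l₁,l₂}_a`. -/
def P12 (k : ℕ) (l1 l2 : Fin k) (a : α) : Phrase α :=
  List.ofFn fun i => if i = l1 then [ofα a] else if i = l2 then [ofα a, ofα a] else []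

/-- `P^{1,1,1;l₁,l₂,l₃}_a`. -/
def P111 (k : ℕ) (l1 l2 l3 : Fin k) (a : α) : Phrase α :=
  List.ofFn fun i => if i = l1 ∨ i = l2 ∨ i = l3 then [ofα a] else []


section Components

/-- The letters of `l` lying in the component with index `i`, when the components of `l` are
numbered from `n` on. -/
def segment (i : ℕ) : ℕ → List (Option (Letter α)) → List (Letter α)
  | _, [] => []
  | n, none :: l => segment i (n + 1) l
  | n, some a :: l => (if n = i then [a] else []) ++ segment i n l

theorem segment_append (i n : ℕ) (x y : List (Option (Letter α))) :
    segment i n (x ++ y) = segment i n x ++ segment i (n + x.countP Option.isNone) y := by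
  induction x generalizing n with
  | nil => simp [segment]
  | cons a x ih =>
    cases a with
    | none => simp [segment, ih, Nat.add_assoc, Nat.add_comm 1]
    | some a => simp [segment, ih]

theorem segment_map_some (i n : ℕ) (w : List (Letter α)) :
    segment i n (w.map some) = if n = i then w else [] := by
  induction w with
  | nil => simp [segment]
  | cons a w ih => by_cases h : n = i <;> simp_all [segment]

theorem notMem_segment {i n : ℕ} {l : List (Option (Letter α))} {a : Letter α}
    (h : some a ∉ l) : a ∉ segment i n l := by
  induction l generalizing n with
  | nil => simp [segment]
  | cons b l ih =>
    have hl : some a ∉ l := fun hm => h (List.mem_cons_of_mem _ hm)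
    cases b with
    | none => exact ih hl
    | some b =>
      have hb : a ≠ b := fun hab => h (by simp [hab])
      rw [segment]
      split_ifs <;> simp [hb, ih hl]

theorem flat_cons_cons (w v : List (Letter α)) (P : Phrase α) :
    flat (w :: v :: P) = w.map some ++ none :: flat (v :: P) := by
  simp [flat, List.intercalate]

theorem flat_singleton (w : List (Letter α)) : flat [w] = w.map some := by
  simp [flat, List.intercalate]

theorem segment_flat (i n : ℕ) (P : Phrase α) :
    segment i n (flat P) = if n ≤ i then comp P (i - n) else [] := by
  induction P generalizing n with
  | nil => simp [flat, List.intercalate, segment, comp]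
  | cons w P ih =>
    cases P with
    | nil =>
      rw [flat_singleton, segment_map_some]
      rcases lt_trichotomy n i with h | h | h
      · obtain ⟨k, rfl⟩ := Nat.exists_eq_add_of_lt h
        simp [comp, Nat.add_assoc]
      · simp [h, comp]
      · simp [h.ne', h.not_ge]
    | cons v P =>
      rw [flat_cons_cons, segment_append, segment_map_some, segment, ih]
      have hc : (w.map some).countP Option.isNone = 0 := by simp [List.countP_eq_zero]
      rw [hc]
      rcases lt_trichotomy n i with h | h | h
      · obtain ⟨k, rfl⟩ := Nat.exists_eq_add_of_lt h
        have h1 : n + k + 1 - n = k + 1 := by omega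
        have h2 : n + k + 1 - (n + 0 + 1) = k := by omega
        rw [h1, h2, if_neg (by omega), if_pos (by omega), if_pos (by omega)]
        simp [comp]
      · simp [h, comp]
      · rw [if_neg (by omega), if_neg (by omega), if_neg (by omega)]
        rfl

theorem comp_eq_segment (P : Phrase α) (i : ℕ) : comp P i = segment i 0 (flat P) := by
  simp [segment_flat]

variable [DecidableEq α]

theorem count_some_flat (P : Phrase α) (a : Letter α) :
    (flat P).count (some a) = P.flatten.count a := by
  induction P with
  | nil => simp [flat, List.intercalate]
  | cons w P ih =>
    have hw : (w.map some).count (some a) = w.count a :=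
      List.count_map_of_injective _ _ (Option.some_injective _) _
    cases P with
    | nil => simp [flat_singleton, hw]
    | cons v P =>
      rw [flat_cons_cons, List.count_append, hw, List.count_cons_of_ne (by simp), ih,
        ← List.count_append, ← List.flatten_cons]

theorem IsGauss.count_some_flat_eq_two {P : Phrase α} (hP : IsGauss P) {a : Letter α}
    (ha : some a ∈ flat P) : (flat P).count (some a) = 2 := by
  rw [count_some_flat]
  refine hP a (List.count_pos_iff.1 ?_)
  rw [← count_some_flat]
  exact List.count_pos_iff.2 ha

theorem IsGauss.count_comp_le {P : Phrase α} (hP : IsGauss P) (i : ℕ) (a : Letter α) :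
    (comp P i).count a ≤ 2 := by
  by_cases hi : i < P.length
  · have h1 : comp P i = P[i] := List.getD_eq_getElem _ _ hi
    have h2 : (comp P i).Sublist P.flatten :=
      h1 ▸ List.sublist_flatten_of_mem (List.getElem_mem hi)
    by_cases ha : a ∈ P.flatten
    · exact (h2.count_le a).trans (hP a ha).le
    · exact (h2.count_le a).trans (by simp [List.count_eq_zero.2 ha])
  · have h1 : comp P i = [] := List.getD_eq_default _ _ (not_lt.1 hi)
    simp [h1]

/-- The subword formed by the letters occurring exactly twice in `w`. -/
def core (w : List (Letter α)) : List (Letter α) := w.filter fun a => w.count a = 2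

theorem nanoIn_core (w : List (Letter α)) : NanoIn Set.univ [core w] := by
  refine ⟨fun a ha => ?_, fun _ _ => Set.mem_univ _⟩
  have ha' : a ∈ core w := by simpa using ha
  have h2 := (List.mem_filter.1 ha').2
  rw [List.flatten_singleton, core, List.count_filter (by exact h2)]
  simpa using h2

theorem core_map {g : Letter α → Letter α} (hg : Function.Injective g) (w : List (Letter α)) :
    core (w.map g) = (core w).map g := by
  rw [core, core, List.filter_map]
  congr 1
  refine List.filter_congr fun a _ => ?_
  simp [List.count_map_of_injective _ _ hg]

theorem Move.homotopic_core {τ : α → α} {w v : List (Letter α)}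
    (h : Move τ [core w] [core v]) : Homotopic τ [core w] [core v] :=
  Relation.ReflTransGen.single ⟨Or.inl h, nanoIn_core w, nanoIn_core v⟩

theorem Homotopic.symm {τ : α → α} {P Q : Phrase α} (h : Homotopic τ P Q) : Homotopic τ Q P :=
  haveI : Std.Symm fun X Y : Phrase α =>
      (Move τ X Y ∨ Move τ Y X) ∧ NanoIn Set.univ X ∧ NanoIn Set.univ Y :=
    ⟨fun _ _ h => ⟨h.1.symm, h.2.2, h.2.1⟩⟩
  Relation.ReflTransGen.stdSymm.symm _ _ h

theorem homotopic_core_map (τ : α → α) {f : ℕ → ℕ} (hf : Function.Injective f)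
    (w : List (Letter α)) :
    Homotopic τ [core w] [core (w.map (Prod.map f id))] := by
  apply Move.homotopic_core
  rw [core_map (hf.prodMap Function.injective_id)]
  exact Move.iso f hf [core w]

theorem core_insert {x p y q z r t : List (Letter α)}
    (h : ∀ a ∈ p ++ q ++ r, a ∉ x ++ y ++ z ++ t) :
    core (x ++ p ++ y ++ q ++ z ++ r ++ t) =
      x.filter (fun a => (x ++ y ++ z ++ t).count a = 2) ++
      p.filter (fun a => (p ++ q ++ r).count a = 2) ++
      y.filter (fun a => (x ++ y ++ z ++ t).count a = 2) ++
      q.filter (fun a => (p ++ q ++ r).count a = 2) ++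
      z.filter (fun a => (x ++ y ++ z ++ t).count a = 2) ++
      r.filter (fun a => (p ++ q ++ r).count a = 2) ++
      t.filter (fun a => (x ++ y ++ z ++ t).count a = 2) := by
  have hc : ∀ a, (x ++ p ++ y ++ q ++ z ++ r ++ t).count a =
      (x ++ y ++ z ++ t).count a + (p ++ q ++ r).count a := fun a => by
    simp only [List.count_append]; omega
  have hold : ∀ l : List (Letter α), (∀ a ∈ l, a ∈ x ++ y ++ z ++ t) →
      l.filter (fun a => (x ++ p ++ y ++ q ++ z ++ r ++ t).count a = 2) =
        l.filter (fun a => (x ++ y ++ z ++ t).count a = 2) := fun l hl =>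
    List.filter_congr fun a ha => by
      rw [hc, List.count_eq_zero.2 fun h' => h a h' (hl a ha), Nat.add_zero]
  have hnew : ∀ l : List (Letter α), (∀ a ∈ l, a ∈ p ++ q ++ r) →
      l.filter (fun a => (x ++ p ++ y ++ q ++ z ++ r ++ t).count a = 2) =
        l.filter (fun a => (p ++ q ++ r).count a = 2) := fun l hl =>
    List.filter_congr fun a ha => by
      rw [hc, List.count_eq_zero.2 (h a (hl a ha)), Nat.zero_add]
  rw [core]
  simp only [List.filter_append]
  rw [hold x, hold y, hold z, hold t, hnew p, hnew q, hnew r] <;>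
    · intro a ha
      simp [ha]

theorem homotopic_core_erase_one (τ : α → α) (P : Prop) [Decidable P] {A : Letter α}
    {x y : List (Letter α)} (h : A ∉ x ++ y) :
    Homotopic τ [core (x ++ (if P then [A, A] else []) ++ y)] [core (x ++ y)] := by
  have h1 := core_insert (x := x) (p := if P then [A, A] else []) (y := y) (q := []) (z := [])
    (r := []) (t := []) (by split_ifs <;> simp_all)
  have h2 := core_insert (x := x) (p := []) (y := y) (q := []) (z := []) (r := []) (t := [])
    (by simp)
  simp only [List.append_nil, List.filter_nil] at h1 h2
  split_ifs at h1 ⊢ with hP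
  · apply Move.homotopic_core
    rw [h1, h2]
    refine Move.h1 _ _ A _ _ ?_ (by simp only [flat_singleton, List.map_append]; rfl)
    simp [flat_singleton]
  · rw [List.append_nil]
    exact Relation.ReflTransGen.refl

theorem homotopic_core_erase_two {τ : α → α} (P Q : Prop) [Decidable P] [Decidable Q]
    {A B : Letter α} {x y z : List (Letter α)} (hAB : B.2 = τ A.2) (hne : A ≠ B)
    (hA : A ∉ x ++ y ++ z) (hB : B ∉ x ++ y ++ z) :
    Homotopic τ
      [core (x ++ (if P then [A, B] else []) ++ y ++ (if Q then [B, A] else []) ++ z)]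
      [core (x ++ y ++ z)] := by
  have h1 := core_insert (x := x) (p := if P then [A, B] else []) (y := y)
    (q := if Q then [B, A] else []) (z := z) (r := []) (t := [])
    (by split_ifs <;> simp_all)
  have h2 := core_insert (x := x) (p := []) (y := y) (q := []) (z := z) (r := []) (t := [])
    (by simp)
  simp only [List.append_nil, List.filter_nil] at h1 h2
  by_cases hPQ : P ∧ Q
  · apply Move.homotopic_core
    rw [h1, h2]
    refine Move.h2 _ _ A B _ _ _ hAB ?_ (by simp only [flat_singleton, List.map_append]; rfl)
    simp [flat_singleton, hPQ.1, hPQ.2, hne, hne.symm]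
  · have : core (x ++ (if P then [A, B] else []) ++ y ++ (if Q then [B, A] else []) ++ z) =
        core (x ++ y ++ z) := by
      rw [h1, h2]
      have := hne.symm
      split_ifs <;> simp_all [List.count_cons]
    rw [this]
    exact Relation.ReflTransGen.refl

theorem homotopic_core_triple (τ : α → α) (P Q R : Prop) [Decidable P] [Decidable Q]
    [Decidable R] {A B C : Letter α} {x y z t : List (Letter α)}
    (hAB : A.2 = B.2) (hBC : B.2 = C.2) (hneAB : A ≠ B) (hneAC : A ≠ C) (hneBC : B ≠ C)
    (hA : A ∉ x ++ y ++ z ++ t) (hB : B ∉ x ++ y ++ z ++ t) (hC : C ∉ x ++ y ++ z ++ t) :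
    Homotopic τ
      [core (x ++ (if P then [A, B] else []) ++ y ++ (if Q then [A, C] else []) ++ z ++
        (if R then [B, C] else []) ++ t)]
      [core (x ++ (if P then [B, A] else []) ++ y ++ (if Q then [C, A] else []) ++ z ++
        (if R then [C, B] else []) ++ t)] := by
  have h1 := core_insert (x := x) (p := if P then [A, B] else []) (y := y)
    (q := if Q then [A, C] else []) (z := z) (r := if R then [B, C] else []) (t := t)
    (by split_ifs <;> simp_all)
  have h2 := core_insert (x := x) (p := if P then [B, A] else []) (y := y)
    (q := if Q then [C, A] else []) (z := z) (r := if R then [C, B] else []) (t := t)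
    (by split_ifs <;> simp_all)
  by_cases hPQR : P ∧ Q ∧ R
  · obtain ⟨hP, hQ, hR⟩ := hPQR
    apply Move.homotopic_core
    rw [h1, h2]
    refine Move.h3 _ _ A B C
      ((x.filter fun a => (x ++ y ++ z ++ t).count a = 2).map some)
      ((y.filter fun a => (x ++ y ++ z ++ t).count a = 2).map some)
      ((z.filter fun a => (x ++ y ++ z ++ t).count a = 2).map some)
      ((t.filter fun a => (x ++ y ++ z ++ t).count a = 2).map some) hAB hBC ?_ ?_ <;>
    simp [flat_singleton, hP, hQ, hR, hneAB, hneAC, hneBC, hneAB.symm, hneAC.symm, hneBC.symm]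
  · have : core (x ++ (if P then [A, B] else []) ++ y ++ (if Q then [A, C] else []) ++ z ++
          (if R then [B, C] else []) ++ t) =
        core (x ++ (if P then [B, A] else []) ++ y ++ (if Q then [C, A] else []) ++ z ++
          (if R then [C, B] else []) ++ t) := by
      rw [h1, h2]
      have := hneAB.symm
      have := hneAC.symm
      have := hneBC.symm
      split_ifs <;> simp_all [List.count_cons]
    rw [this]
    exact Relation.ReflTransGen.refl

theorem Move.homotopic_core_comp {τ : α → α} {P Q : Phrase α} (h : Move τ P Q)
    (hP : IsGauss P) (i : ℕ) : Homotopic τ [core (comp P i)] [core (comp Q i)] := by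
  have hseg : ∀ n (A B : Letter α), segment i n [some A, some B] = if n = i then [A, B] else [] :=
    fun n A B => segment_map_some i n [A, B]
  have hnone : ∀ A B : Letter α, [some A, some B].countP Option.isNone = 0 := fun _ _ => rfl
  cases h with
  | iso f hf P =>
    have h1 : comp (rename f P) i = (comp P i).map (Prod.map f id) := by
      exact List.getD_map P [] (n := i) (List.map (Prod.map f id))
    rw [h1]
    exact homotopic_core_map τ hf _
  | h1 P Q A x y hp hq =>
    have hA := hP.count_some_flat_eq_two (a := A) (by simp [hp])
    simp [hp] at hA
    simp only [comp_eq_segment, hp, hq, segment_append, hseg, List.countP_append, hnone,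
      Nat.add_zero]
    apply homotopic_core_erase_one
    simp only [List.mem_append, not_or]
    refine ⟨?_, ?_⟩ <;> exact notMem_segment (List.count_eq_zero.1 (by omega))
  | h2 P Q A B x y z hAB hp hq =>
    have hA := hP.count_some_flat_eq_two (a := A) (by simp [hp])
    have hB := hP.count_some_flat_eq_two (a := B) (by simp [hp])
    have hne : A ≠ B := by
      rintro rfl
      simp [hp] at hA
      omega
    simp [hp, hne, hne.symm] at hA hB
    simp only [comp_eq_segment, hp, hq, segment_append, hseg, List.countP_append, hnone,
      Nat.add_zero]
    apply homotopic_core_erase_two _ _ hAB hne <;>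
    · simp only [List.mem_append, not_or]
      refine ⟨⟨?_, ?_⟩, ?_⟩ <;> exact notMem_segment (List.count_eq_zero.1 (by omega))
  | h3 P Q A B C x y z t hAB hBC hp hq =>
    have hA := hP.count_some_flat_eq_two (a := A) (by simp [hp])
    have hB := hP.count_some_flat_eq_two (a := B) (by simp [hp])
    have hC := hP.count_some_flat_eq_two (a := C) (by simp [hp])
    have hneAB : A ≠ B := by
      rintro rfl
      simp [hp, List.count_cons] at hA
      omega
    have hneAC : A ≠ C := by
      rintro rfl
      simp [hp, List.count_cons] at hA
      omega
    have hneBC : B ≠ C := by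
      rintro rfl
      simp [hp, List.count_cons] at hB
      omega
    simp [hp, hneAB, hneAB.symm, hneAC, hneAC.symm, hneBC, hneBC.symm] at hA hB hC
    simp only [comp_eq_segment, hp, hq, segment_append, hseg, List.countP_append, hnone,
      Nat.add_zero]
    apply homotopic_core_triple τ _ _ _ hAB hBC hneAB hneAC hneBC <;>
    · simp only [List.mem_append, not_or]
      refine ⟨⟨⟨?_, ?_⟩, ?_⟩, ?_⟩ <;> exact notMem_segment (List.count_eq_zero.1 (by omega))

theorem desingWord_eq_filter {m seen : Letter α → ℕ} {w : List (Letter α)}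
    (hm : ∀ A, m A ≤ 2) (h : ∀ A, seen A + w.count A = m A) :
    desingWord m w seen = (w.filter fun A => m A = 2).map fun A => dLetter A 1 2 := by
  induction w generalizing seen with
  | nil => rfl
  | cons A w ih =>
    have hA := h A
    have hA2 := hm A
    rw [List.count_cons_self] at hA
    rw [desingWord, ih fun B => ?_]
    · rcases (by omega : m A = 1 ∨ m A = 2) with h1 | h2
      · have h0 : seen A = 0 := by omega
        simp [h1, h0, repl]
      · rcases (by omega : seen A = 0 ∨ seen A = 1) with h0 | h0 <;> simp [h2, h0, repl]
    · have hB := h B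
      by_cases hBA : B = A
      · subst hBA
        simp at hB ⊢
        omega
      · rw [List.count_cons_of_ne (Ne.symm hBA)] at hB
        simpa [hBA] using hB

theorem homotopic_core_desing (τ : α → α) {w : List (Letter α)} (h : ∀ A, w.count A ≤ 2) :
    Homotopic τ [core w] (desing [w]) := by
  have hf : Function.Injective fun n => Nat.pair n (Nat.pair 1 2) := fun a b h =>
    (Nat.pair_eq_pair.1 h).1
  have h1 : desing [w] = [core (w.map (Prod.map (fun n => Nat.pair n (Nat.pair 1 2)) id))] := by
    rw [core_map (hf.prodMap Function.injective_id)]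
    simp only [desing, desingAux, List.flatten_singleton]
    rw [desingWord_eq_filter h (by simp)]
    rfl
  rw [h1]
  exact homotopic_core_map τ hf w

theorem Homotopic.core_comp {τ : α → α} {P Q : Phrase α} (h : Homotopic τ P Q) (i : ℕ) :
    Homotopic τ [core (comp P i)] [core (comp Q i)] := by
  refine Relation.ReflTransGen.lift' (fun X => [core (comp X i)]) (fun X Y hXY => ?_) _ _ h
  obtain ⟨hm | hm, hX, hY⟩ := hXY
  · exact hm.homotopic_core_comp hX.1 i
  · exact (hm.homotopic_core_comp hY.1 i).symm

end Components

/-- **Lemma 4.3** of the paper: let `P₁ = (w₁|…|w_k)` and `P₂ = (v₁|…|v_k)` be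
nanophrases of length `k` over `α`.  If `P₁` and `P₂` are homotopic as
nanophrases, then `w_i` and `v_i` are homotopic as étale words over `α` for
every `i ∈ {1,…,k}`. -/
theorem components_homotopic_as_etale_words
    {α : Type*} [Fintype α] [DecidableEq α] (τ : α → α) (hτ : Function.Involutive τ)
    (k : ℕ) (P Q : Phrase α) (hPk : P.length = k) (hQk : Q.length = k)
    (hP : IsGauss P) (hQ : IsGauss Q) (h : Homotopic τ P Q) :
    ∀ i : Fin k, EHomotopic τ [comp P i] [comp Q i] := by
  intro i
  exact (homotopic_core_desing τ (hP.count_comp_le i)).symm.trans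
    ((h.core_comp i).trans (homotopic_core_desing τ (hQ.count_comp_le i)))

end Nano
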